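/- Let d ≥ 1, R ∈ ℕ, let u : ℤ^d → ℝ be harmonic on the ball B_{5R} (i.e. (Δu)(x) = 0 for all x with ‖x‖₁ ≤ 5R − 1), and let 0 < δ < 1/4. Then for every natural number n with 0 ≤ n ≤ R, Q_u(2n) ≤ √( Q_u(n) · Q_u(⌈4(1+δ)n⌉) ) + 2^{−2nδ} · Q_u(⌈4(1+δ)n⌉), where Q_u(m) = (A^m(u²))(0) and ⌈·⌉ is the ceiling function. -/

import Mathlib

/-- The standard generators of `ℤ^d`: `±e_i`, indexed by `Fin d × Bool`. -/
def latticeGen (d : ℕ) (s : Fin d × Bool) : Fin d → ℤ :=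
  fun j => if s.1 = j then (if s.2 then 1 else -1) else 0

/-- The averaging operator `(A f)(x) = (1/(2d)) ∑_{s ∈ S} f(x+s)`. -/
noncomputable def latticeAvg (d : ℕ) (f : (Fin d → ℤ) → ℝ) : (Fin d → ℤ) → ℝ :=
  fun x => (1 / (2 * (d : ℝ))) * ∑ s : Fin d × Bool, f (x + latticeGen d s)

/-- The discrete Laplacian `Δf = Af − f`. -/
noncomputable def latticeLap (d : ℕ) (f : (Fin d → ℤ) → ℝ) : (Fin d → ℤ) → ℝ :=
  fun x => latticeAvg d f x - f x

/-- The growth function `Q_u(n) = (Aⁿ (u²))(0)`. -/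
noncomputable def growthQ (d : ℕ) (u : (Fin d → ℤ) → ℝ) (n : ℕ) : ℝ :=
  (latticeAvg d)^[n] (fun y => (u y) ^ 2) 0

/-- Forward difference of a function on `ℕ`. -/
def fdiff (g : ℕ → ℝ) : ℕ → ℝ := fun n => g (n + 1) - g n

/-- The averaging operator as a linear endomorphism. -/
noncomputable def latticeAvgLin (d : ℕ) : Module.End ℝ ((Fin d → ℤ) → ℝ) where
  toFun := latticeAvg d
  map_add' f g := by
    ext x
    simp [latticeAvg, Finset.sum_add_distrib, mul_add]
  map_smul' c f := by
    ext x
    simp only [latticeAvg, Pi.smul_apply, smul_eq_mul, ← Finset.mul_sum, RingHom.id_apply]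
    ring

/-- The discrete Laplacian as a linear endomorphism. -/
noncomputable def latticeLapLin (d : ℕ) : Module.End ℝ ((Fin d → ℤ) → ℝ) :=
  latticeAvgLin d - 1

theorem latticeLapLin_apply (d : ℕ) (f : (Fin d → ℤ) → ℝ) :
    latticeLapLin d f = latticeLap d f := rfl

theorem sum_abs_add_latticeGen_le (d : ℕ) (x : Fin d → ℤ) (s : Fin d × Bool) :
    ∑ i, |(x + latticeGen d s) i| ≤ ∑ i, |x i| + 1 := by
  have hgen : ∑ i, |latticeGen d s i| = 1 := by
    have h : ∀ i, |latticeGen d s i| = if s.1 = i then 1 else 0 := by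
      intro i
      unfold latticeGen
      split_ifs <;> simp
    simp [h]
  calc ∑ i, |(x + latticeGen d s) i| ≤ ∑ i, (|x i| + |latticeGen d s i|) :=
        Finset.sum_le_sum fun i _ => abs_add_le _ _
    _ = ∑ i, |x i| + 1 := by rw [Finset.sum_add_distrib, hgen]

/-- The Laplacian at a point only depends on the values on the neighbours of the point. -/
theorem latticeLap_congr_of_eqOn_ball (d : ℕ) {r : ℤ} {f g : (Fin d → ℤ) → ℝ}
    (h : ∀ x : Fin d → ℤ, ∑ i, |x i| ≤ r + 1 → f x = g x) (x : Fin d → ℤ)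
    (hx : ∑ i, |x i| ≤ r) : latticeLap d f x = latticeLap d g x := by
  unfold latticeLap latticeAvg
  rw [h x (by omega)]
  congr 2
  refine Finset.sum_congr rfl fun s _ => h _ ?_
  have := sum_abs_add_latticeGen_le d x s
  omega

theorem latticeLapLin_pow_congr_of_eqOn_ball (d k : ℕ) {r : ℤ} {f g : (Fin d → ℤ) → ℝ}
    (h : ∀ x : Fin d → ℤ, ∑ i, |x i| ≤ r + k → f x = g x) (x : Fin d → ℤ)
    (hx : ∑ i, |x i| ≤ r) : (latticeLapLin d ^ k) f x = (latticeLapLin d ^ k) g x := by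
  induction k generalizing f g with
  | zero => exact h x (by simpa using hx)
  | succ k ih =>
    rw [pow_succ, Module.End.mul_apply, Module.End.mul_apply]
    refine ih fun y hy => ?_
    refine latticeLap_congr_of_eqOn_ball d (fun z hz => h z ?_) y hy
    push_cast
    omega

/-- Finite differences in the direction of a generator commute with the Laplacian. -/
theorem latticeLap_sub_translate (d : ℕ) (v : (Fin d → ℤ) → ℝ) (t x : Fin d → ℤ) :
    latticeLap d (fun y => v (y + t) - v y) x = latticeLap d v (x + t) - latticeLap d v x := by
  simp only [latticeLap, latticeAvg, Finset.sum_sub_distrib, add_right_comm x _ t]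
  ring

/-- The carré du champ identity at a point of harmonicity. -/
theorem latticeLap_sq_of_latticeLap_eq_zero (d : ℕ) (hd : 1 ≤ d) (v : (Fin d → ℤ) → ℝ)
    (x : Fin d → ℤ) (hx : latticeLap d v x = 0) :
    latticeLap d (fun y => v y ^ 2) x =
      (1 / (2 * (d : ℝ))) * ∑ s, (v (x + latticeGen d s) - v x) ^ 2 := by
  have hd' : (d : ℝ) ≠ 0 := by positivity
  have hv : ∑ s, v (x + latticeGen d s) = 2 * d * v x := by
    unfold latticeLap latticeAvg at hx
    field_simp at hx
    linarith
  have hsum : ∑ s, (v (x + latticeGen d s) - v x) ^ 2 =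
      ∑ s, v (x + latticeGen d s) ^ 2 - 2 * d * v x ^ 2 := by
    simp only [sub_sq, Finset.sum_add_distrib, Finset.sum_sub_distrib, ← Finset.sum_mul,
      ← Finset.mul_sum, hv, Finset.sum_const, Finset.card_univ, Fintype.card_prod,
      Fintype.card_fin, Fintype.card_bool, nsmul_eq_mul]
    push_cast
    ring
  rw [hsum]
  unfold latticeLap latticeAvg
  field_simp

/-- Iterated Laplacians of the square of a harmonic function are nonnegative. -/
theorem latticeLapLin_pow_sq_nonneg (d : ℕ) (hd : 1 ≤ d) (k : ℕ) {r : ℤ}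
    {v : (Fin d → ℤ) → ℝ}
    (hv : ∀ x : Fin d → ℤ, ∑ i, |x i| < r + k → latticeLap d v x = 0) (x : Fin d → ℤ)
    (hx : ∑ i, |x i| ≤ r) : 0 ≤ (latticeLapLin d ^ k) (fun y => v y ^ 2) x := by
  induction k generalizing v with
  | zero => exact sq_nonneg (v x)
  | succ k ih =>
    push_cast at hv
    have hlap : (latticeLapLin d ^ k) (latticeLapLin d fun y => v y ^ 2) x =
        (latticeLapLin d ^ k) ((1 / (2 * (d : ℝ))) • ∑ s,
          fun y => (v (y + latticeGen d s) - v y) ^ 2) x := by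
      refine latticeLapLin_pow_congr_of_eqOn_ball d k (fun y hy => ?_) x hx
      rw [latticeLapLin_apply,
        latticeLap_sq_of_latticeLap_eq_zero d hd v y (hv y (by omega))]
      simp
    rw [pow_succ, Module.End.mul_apply, hlap, map_smul, map_sum, Pi.smul_apply,
      Finset.sum_apply]
    refine mul_nonneg (by positivity) (Finset.sum_nonneg fun s _ => ih fun y hy => ?_)
    have := sum_abs_add_latticeGen_le d y s
    rw [latticeLap_sub_translate, hv _ (by omega), hv _ (by omega), sub_zero]

/-- Newton expansion of the growth function. -/
theorem growthQ_eq_sum_choose_mul (d : ℕ) (u : (Fin d → ℤ) → ℝ) (n : ℕ) :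
    growthQ d u n = ∑ k ∈ Finset.range (n + 1),
      (n.choose k : ℝ) * (latticeLapLin d ^ k) (fun y => u y ^ 2) 0 := by
  have hpow : latticeAvgLin d ^ n =
      ∑ k ∈ Finset.range (n + 1), (n.choose k : ℝ) • latticeLapLin d ^ k := by
    have : latticeAvgLin d = latticeLapLin d + 1 := by simp [latticeLapLin]
    rw [this, (Commute.one_right (latticeLapLin d)).add_pow]
    refine Finset.sum_congr rfl fun k _ => ?_
    rw [one_pow, mul_one, ← nsmul_eq_mul', Nat.cast_smul_eq_nsmul]
  have hQ : growthQ d u n = (latticeAvgLin d ^ n) (fun y => u y ^ 2) 0 := by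
    rw [Module.End.pow_apply]
    rfl
  rw [hQ, hpow]
  simp [LinearMap.sum_apply, Finset.sum_apply]

theorem cast_choose_succ_mul {m k : ℕ} (hk : k ≤ m) :
    (m.choose (k + 1) : ℝ) * (k + 1) = m.choose k * (m - k) := by
  have h := Nat.choose_succ_right_eq m k
  rw [← Nat.cast_sub hk]
  exact_mod_cast h

theorem choose_two_mul_mul_two_pow_le {n N : ℕ} (hN : 4 * n ≤ N) (k : ℕ) :
    (2 * n).choose k * 2 ^ k ≤ N.choose k := by
  induction k with
  | zero => simp
  | succ k ih =>
    refine Nat.le_of_mul_le_mul_right (c := k + 1) ?_ k.succ_pos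
    have hsub : 2 * (2 * n - k) ≤ N - k := by omega
    calc (2 * n).choose (k + 1) * 2 ^ (k + 1) * (k + 1)
        = (2 * n).choose (k + 1) * (k + 1) * 2 ^ (k + 1) := by ring
      _ = (2 * n).choose k * 2 ^ k * (2 * (2 * n - k)) := by
          rw [Nat.choose_succ_right_eq]; ring
      _ ≤ N.choose k * (N - k) := Nat.mul_le_mul ih hsub
      _ = N.choose (k + 1) * (k + 1) := (Nat.choose_succ_right_eq N k).symm

theorem choose_two_mul_sq_le {n N k : ℕ} {δ : ℝ} (hδ0 : 0 < δ) (hδ1 : δ < 1 / 4)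
    (hN : 4 * (1 + δ) * (n : ℝ) ≤ N) (hk : (k : ℝ) ≤ 2 * n * δ) :
    ((2 * n).choose k : ℝ) ^ 2 ≤ n.choose k * N.choose k := by
  induction k with
  | zero => simp
  | succ k ih =>
    push_cast at hk
    have hn : (0 : ℝ) ≤ n := n.cast_nonneg
    have hk0 : (0 : ℝ) ≤ k := k.cast_nonneg
    have hkn : (k : ℝ) ≤ n := by nlinarith
    have hnN : (n : ℝ) ≤ N := by nlinarith
    have hkn' : k ≤ n := by exact_mod_cast hkn
    have hnN' : n ≤ N := by exact_mod_cast hnN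
    have h2 := cast_choose_succ_mul (m := 2 * n) (k := k) (by omega)
    have h1 := cast_choose_succ_mul hkn'
    have h4 := cast_choose_succ_mul (hkn'.trans hnN')
    push_cast at h2
    have hfac : (2 * (n : ℝ) - k) ^ 2 ≤ (n - k) * (N - k) := by
      have hstep : (n - k : ℝ) * (4 * (1 + δ) * n - k) ≤ (n - k) * (N - k) :=
        mul_le_mul_of_nonneg_left (by linarith) (by linarith)
      have hlin : 0 ≤ 4 * δ * n - (1 + 4 * δ) * k := by nlinarith
      nlinarith [mul_nonneg hn hlin]
    refine le_of_mul_le_mul_right (a := ((k : ℝ) + 1) ^ 2) ?_ (by positivity)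
    calc ((2 * n).choose (k + 1) : ℝ) ^ 2 * ((k : ℝ) + 1) ^ 2
        = ((2 * n).choose k : ℝ) ^ 2 * (2 * n - k) ^ 2 := by rw [← mul_pow, h2, mul_pow]
      _ ≤ (n.choose k * N.choose k : ℝ) * ((n - k) * (N - k)) :=
          mul_le_mul (ih (by linarith)) hfac (sq_nonneg _) (by positivity)
      _ = (n.choose k * (n - k) : ℝ) * (N.choose k * (N - k)) := by ring
      _ = n.choose (k + 1) * N.choose (k + 1) * ((k : ℝ) + 1) ^ 2 := by
          rw [← h1, ← h4]; ring

/-- Three-term inequality for binomial transforms of nonnegative sequences. -/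
theorem sum_choose_two_mul_le {n N : ℕ} {δ : ℝ} (hδ0 : 0 < δ) (hδ1 : δ < 1 / 4)
    (hN : 4 * (1 + δ) * (n : ℝ) ≤ N) {a : ℕ → ℝ} (ha : ∀ k ≤ N, 0 ≤ a k) :
    ∑ k ∈ Finset.range (2 * n + 1), ((2 * n).choose k : ℝ) * a k ≤
      √((∑ k ∈ Finset.range (n + 1), (n.choose k : ℝ) * a k) *
          ∑ k ∈ Finset.range (N + 1), (N.choose k : ℝ) * a k) +
        (2 : ℝ) ^ (-(2 * (n : ℝ) * δ)) *
          ∑ k ∈ Finset.range (N + 1), (N.choose k : ℝ) * a k := by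
  have hn0 : (0 : ℝ) ≤ n := n.cast_nonneg
  have h4 : 4 * n ≤ N := by
    have : (4 : ℝ) * n ≤ N := by nlinarith
    exact_mod_cast this
  have hterm : ∀ m, ∀ k ∈ Finset.range (N + 1), 0 ≤ (Nat.choose m k : ℝ) * a k :=
    fun m k hk => mul_nonneg (by positivity) (ha k (Nat.lt_succ_iff.1 (Finset.mem_range.1 hk)))
  rw [← Finset.sum_filter_add_sum_filter_not (Finset.range (2 * n + 1))
    fun k : ℕ => (k : ℝ) ≤ 2 * n * δ]
  refine add_le_add ?_ ?_
  · set s := (Finset.range (2 * n + 1)).filter fun k : ℕ => (k : ℝ) ≤ 2 * n * δ with hs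
    have hsn : s ⊆ Finset.range (n + 1) := by
      intro k hk
      have hk' := (Finset.mem_filter.1 hk).2
      have : (k : ℝ) ≤ n := by nlinarith
      have : k ≤ n := by exact_mod_cast this
      exact Finset.mem_range.2 (by omega)
    have hnN : Finset.range (n + 1) ⊆ Finset.range (N + 1) :=
      Finset.range_subset_range.2 (by omega)
    have hsN := hsn.trans hnN
    calc ∑ k ∈ s, ((2 * n).choose k : ℝ) * a k
        ≤ ∑ k ∈ s, √(n.choose k * a k) * √(N.choose k * a k) := by
          refine Finset.sum_le_sum fun k hk => ?_
          rw [← Real.sqrt_mul (hterm n k (hsN hk))]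
          refine Real.le_sqrt_of_sq_le ?_
          have := choose_two_mul_sq_le hδ0 hδ1 hN (Finset.mem_filter.1 hk).2
          nlinarith [mul_le_mul_of_nonneg_right this (sq_nonneg (a k))]
      _ = ∑ k : s, √(n.choose k * a k) * √(N.choose k * a k) :=
          (Finset.sum_coe_sort s fun k => √(n.choose k * a k) * √(N.choose k * a k)).symm
      _ ≤ √(∑ k : s, n.choose k * a k) * √(∑ k : s, N.choose k * a k) :=
          Real.sum_sqrt_mul_sqrt_le _ (fun k => hterm n k (hsN k.2))
            fun k => hterm N k (hsN k.2)
      _ = √((∑ k ∈ s, n.choose k * a k) * ∑ k ∈ s, N.choose k * a k) := by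
          rw [Finset.sum_coe_sort s fun k => (n.choose k : ℝ) * a k,
            Finset.sum_coe_sort s fun k => (N.choose k : ℝ) * a k,
            Real.sqrt_mul (Finset.sum_nonneg fun k hk => hterm n k (hsN hk))]
      _ ≤ _ := by
          refine Real.sqrt_le_sqrt (mul_le_mul ?_ ?_ ?_ ?_)
          · exact Finset.sum_le_sum_of_subset_of_nonneg hsn fun k hk _ => hterm n k (hnN hk)
          · exact Finset.sum_le_sum_of_subset_of_nonneg hsN fun k hk _ => hterm N k hk
          · exact Finset.sum_nonneg fun k hk => hterm N k (hsN hk)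
          · exact Finset.sum_nonneg fun k hk => hterm n k (hnN hk)
  · rw [Finset.mul_sum]
    have hsub : ((Finset.range (2 * n + 1)).filter fun k : ℕ => ¬ (k : ℝ) ≤ 2 * n * δ) ⊆
        Finset.range (N + 1) :=
      (Finset.filter_subset _ _).trans (Finset.range_subset_range.2 (by omega))
    refine (Finset.sum_le_sum fun k hk => ?_).trans
      (Finset.sum_le_sum_of_subset_of_nonneg hsub fun k hk _ =>
        mul_nonneg (by positivity) (hterm N k hk))
    rw [← mul_assoc]
    refine mul_le_mul_of_nonneg_right ?_
      (ha k (Nat.lt_succ_iff.1 (Finset.mem_range.1 (hsub hk))))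
    have hk' : 2 * (n : ℝ) * δ ≤ k := (not_le.1 (Finset.mem_filter.1 hk).2).le
    have hpow : (2 : ℝ) ^ (2 * (n : ℝ) * δ) ≤ 2 ^ k := by
      rw [← Real.rpow_natCast]
      exact Real.rpow_le_rpow_of_exponent_le (by norm_num) hk'
    have hch : ((2 * n).choose k : ℝ) * 2 ^ k ≤ N.choose k := by
      exact_mod_cast choose_two_mul_mul_two_pow_le h4 k
    rw [Real.rpow_neg (by norm_num), ← div_eq_inv_mul, le_div_iff₀ (by positivity)]
    exact (mul_le_mul_of_nonneg_left hpow (by positivity)).trans hch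

theorem stmt_13 (d : ℕ) (hd : 1 ≤ d) (R : ℕ) (u : (Fin d → ℤ) → ℝ)
    (hu : ∀ x : Fin d → ℤ, (∑ i, |x i|) ≤ 5 * (R : ℤ) - 1 → latticeLap d u x = 0)
    (δ : ℝ) (hδ0 : 0 < δ) (hδ1 : δ < 1 / 4) :
    ∀ n : ℕ, n ≤ R →
      growthQ d u (2 * n) ≤
        Real.sqrt (growthQ d u n * growthQ d u ⌈4 * (1 + δ) * (n : ℝ)⌉₊)
          + (2 : ℝ) ^ (-(2 * (n : ℝ) * δ)) * growthQ d u ⌈4 * (1 + δ) * (n : ℝ)⌉₊ := by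
  intro n hn
  have hN := Nat.le_ceil (4 * (1 + δ) * (n : ℝ))
  have hNR : ⌈4 * (1 + δ) * (n : ℝ)⌉₊ ≤ 5 * R := by
    refine Nat.ceil_le.2 ?_
    have hn' : (n : ℝ) ≤ R := by exact_mod_cast hn
    have hn0 : (0 : ℝ) ≤ n := n.cast_nonneg
    push_cast
    nlinarith
  simp only [growthQ_eq_sum_choose_mul]
  refine sum_choose_two_mul_le hδ0 hδ1 hN fun k hk => ?_
  refine latticeLapLin_pow_sq_nonneg d hd k (r := 0) (fun x hx => hu x ?_) 0 (by simp)
  omega
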